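/- Minimum joint survival probability. Let m ≥ 1 and let t : Fin m → ℕ with t i ≥ 1 for every i and ∑ i, t i = k. Then (∏ i, p_{t i})³ ≥ (24/49)^k in ℚ, where p_s := ∏_{i=1}^{s-1} (2^s − 2^(s−i))/(2^s − 1). In other words, among all groupings of k variables into same-colored groups of sizes t_1, …, t_m, the joint survival probability ∏ i p_{t i} is at least p_3^(k/3), the value attained (for 3 | k) by k/3 groups of size 3. -/

import Mathlib

/-- The subspace survival probability for a color group of size `s`:
`p s = ∏_{i=1}^{s-1} (2^s − 2^(s−i))/(2^s − 1)`, with `p 1 = 1` (the empty product).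
In particular `p 3 = 24/49`. -/
def p (s : ℕ) : ℚ :=
  ∏ i ∈ Finset.Icc 1 (s - 1), ((2 ^ s - 2 ^ (s - i)) / (2 ^ s - 1) : ℚ)

lemma q_bound (n : ℕ) (hn : 1 ≤ n) :
    (1 / 4 + (1 / 2) ^ (n + 1) : ℚ) ≤ ∏ i ∈ Finset.Icc 1 n, (1 - (1 / 2 : ℚ) ^ i) := by
  induction n, hn using Nat.le_induction with
  | base => norm_num
  | succ n hn ih =>
    rw [Finset.prod_Icc_succ_top (by omega)]
    have h0 : (0 : ℚ) < (1 / 2) ^ (n + 1) := by positivity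
    have h1 : ((1 : ℚ) / 2) ^ (n + 1) ≤ (1 / 2) ^ 2 :=
      pow_le_pow_of_le_one (by norm_num) (by norm_num) (by omega)
    rw [pow_succ _ (n + 1)]
    generalize ((1 : ℚ) / 2) ^ (n + 1) = x at *
    have h2 := mul_le_mul_of_nonneg_right ih (show 0 ≤ 1 - x by linarith)
    nlinarith

lemma p_ge_quarter (s : ℕ) (hs : 2 ≤ s) : (1 / 4 : ℚ) ≤ p s := by
  have h := q_bound (s - 1) (by omega)
  have h0 : (0 : ℚ) < (1 / 2) ^ (s - 1 + 1) := by positivity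
  have h2 : ∏ i ∈ Finset.Icc 1 (s - 1), (1 - (1 / 2 : ℚ) ^ i) ≤ p s := by
    unfold p
    apply Finset.prod_le_prod
    · intro i _
      have : ((1 : ℚ) / 2) ^ i ≤ 1 := pow_le_one₀ (by norm_num) (by norm_num)
      linarith
    · intro i hi
      rw [Finset.mem_Icc] at hi
      have h1 : (2 : ℚ) ^ s = 2 ^ (s - i) * 2 ^ i := by rw [← pow_add]; congr 1; omega
      have h3 : (1 : ℚ) < 2 ^ s := one_lt_pow₀ (by norm_num) (by omega)
      have h4 : ((1 : ℚ) / 2) ^ i ≤ 1 := pow_le_one₀ (by norm_num) (by norm_num)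
      have h5 : (2 : ℚ) ^ i * (1 / 2) ^ i = 1 := by rw [← mul_pow]; norm_num
      rw [le_div_iff₀ (by linarith)]
      have h6 : (2 : ℚ) ^ s * (1 / 2) ^ i = 2 ^ (s - i) := by rw [h1, mul_assoc, h5, mul_one]
      nlinarith
  linarith

lemma p_cube (s : ℕ) (hs : 1 ≤ s) : (24 / 49 : ℚ) ^ s ≤ p s ^ 3 := by
  by_cases h : s < 6
  · interval_cases s <;> norm_num [p, Finset.prod_Icc_succ_top]
  · have h1 : (24 / 49 : ℚ) ^ s ≤ (24 / 49) ^ 6 :=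
      pow_le_pow_of_le_one (by norm_num) (by norm_num) (by omega)
    have h2 : (1 / 4 : ℚ) ^ 3 ≤ p s ^ 3 :=
      pow_le_pow_left₀ (by norm_num) (p_ge_quarter s (by omega)) 3
    norm_num at h1 h2 ⊢
    linarith

/-- **Minimum joint survival probability.** For any grouping of `k` variables into
`m ≥ 1` same-colored groups of sizes `t 0, …, t (m-1)` (each at least 1, summing to
`k`), the joint survival probability `∏ i, p (t i)` satisfies
`(∏ i, p (t i))³ ≥ (24/49)^k`, i.e. it is at least `p 3 ^ (k/3)`, the value attained
(for `3 ∣ k`) by `k/3` groups of size 3. -/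
theorem min_joint_survival (m k : ℕ) (hm : 1 ≤ m) (t : Fin m → ℕ)
    (ht : ∀ i, 1 ≤ t i) (hsum : ∑ i, t i = k) :
    (∏ i, p (t i)) ^ 3 ≥ (24 / 49 : ℚ) ^ k := by
  rw [← hsum, ← Finset.prod_pow_eq_pow_sum, ← Finset.prod_pow]
  exact Finset.prod_le_prod (fun i _ => by positivity) (fun i _ => p_cube _ (ht i))
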